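/- Let L be a commutative incline, i.e., L carries a SemilatticeSup structure and a CommSemigroup multiplication satisfying x*(y ⊔ z) = x*y ⊔ x*z and x ⊔ x*y = x for all x, y, z ∈ L. For every matrix A : Fin 3 → Fin 3 → L with powers defined entrywise by (A^m)_{ij} = the supremum over all walks V : Fin (m+1) → Fin 3 with V 0 = i, V m = j of ∏_{s=0}^{m-1} A (V s) (V (s+1)), we have A^{233} ≤ A^5 entrywise, i.e., for all i j : Fin 3, (A^{233})_{ij} ≤ (A^5)_{ij}. -/

import Mathlib

/-- The product of the entries of a matrix `A` along a walk of positive length `l + 1`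
on `Fin n` (a walk of length `l + 1` being a function `Fin (l + 2) → Fin n`). -/
def walkProd {L : Type*} [Mul L] {n : ℕ} (A : Fin n → Fin n → L) :
    {l : ℕ} → (Fin (l + 2) → Fin n) → L
  | 0, V => A (V 0) (V 1)
  | l + 1, V => A (V 0) (V 1) * walkProd A (fun t : Fin (l + 2) => V t.succ)

/-- The `(i, j)` entry of the `(m + 1)`-st power of the matrix `A` over a semilattice:
the (finite, nonempty) supremum, over all walks `V` of length `m + 1` on `Fin 3`
with `V 0 = i` and `V (m + 1) = j`, of the product of the entries of `A` along `V`. -/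
def powEntry {L : Type*} [SemilatticeSup L] [Mul L]
    (A : Fin 3 → Fin 3 → L) (m : ℕ) (i j : Fin 3) : L :=
  Finset.sup'
    (Finset.univ.filter fun V : Fin (m + 2) → Fin 3 => V 0 = i ∧ V (Fin.last (m + 1)) = j)
    ⟨fun t => if t = 0 then i else j, by
      simp only [Finset.mem_filter, Finset.mem_univ, true_and]
      constructor
      · simp
      · rw [if_neg (by simp [Fin.ext_iff])]⟩
    (fun V => walkProd A V)

/-- The list of edges of the walk that starts at `v` and then visits the vertices in a list. -/
def walkEdges {α : Type*} : α → List α → List (α × α)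
  | _, [] => []
  | v, u :: l => (v, u) :: walkEdges u l

theorem walkEdges_append {α : Type*} (v : α) (l₁ l₂ : List α) :
    walkEdges v (l₁ ++ l₂) = walkEdges v l₁ ++ walkEdges (l₁.getLastD v) l₂ := by
  induction l₁ generalizing v with
  | nil => simp [walkEdges]
  | cons u l ih => simp only [List.cons_append, walkEdges, ih, List.getLastD_cons]

theorem getLastD_append_getLastD {α : Type*} (v : α) (l₁ l₂ : List α) :
    (l₁ ++ l₂).getLastD v = l₂.getLastD (l₁.getLastD v) := by
  induction l₁ generalizing v with
  | nil => simp
  | cons u l ih => simp only [List.cons_append, ih, List.getLastD_cons]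

/-- An injective encoding of the nine edges on three vertices by prime numbers. -/
def edgePrime (e : Fin 3 × Fin 3) : ℕ :=
  (3 * e.1.val + e.2.val) * (3 * e.1.val + e.2.val + 1) + 11

theorem edgePrime_prime (e : Fin 3 × Fin 3) : (edgePrime e).Prime := by
  obtain ⟨v, u⟩ := e
  fin_cases v <;> fin_cases u <;> norm_num [edgePrime]

theorem edgePrime_injective : Function.Injective edgePrime := by
  intro e f
  revert e f
  decide

theorem mem_of_edgePrime_dvd {e : Fin 3 × Fin 3} {E : List (Fin 3 × Fin 3)}
    (h : edgePrime e ∣ (E.map edgePrime).prod) : e ∈ E := by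
  obtain ⟨p, hp, hdvd⟩ := ((edgePrime_prime e).prime.dvd_prod_iff).1 h
  obtain ⟨f, hf, rfl⟩ := List.mem_map.1 hp
  rw [Nat.prime_dvd_prime_iff_eq (edgePrime_prime e) (edgePrime_prime f)] at hdvd
  rwa [edgePrime_injective hdvd]

theorem prod_map_edgePrime_div {e : Fin 3 × Fin 3} {E : List (Fin 3 × Fin 3)} (h : e ∈ E) :
    (E.map edgePrime).prod / edgePrime e = ((E.erase e).map edgePrime).prod := by
  rw [((List.perm_cons_erase h).map edgePrime).prod_eq, List.map_cons, List.prod_cons,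
    Nat.mul_div_cancel_left _ (edgePrime_prime e).pos]

/-- Decide whether some walk of length `n` from `v` to `j` uses each edge at most as often as it
occurs in the list of edges encoded by the product `N` of its primes. -/
def hasWalkWithin : ℕ → Fin 3 → Fin 3 → ℕ → Bool
  | 0, v, j, _ => Nat.beq v j
  | n + 1, v, j, N =>
    [⟨0, by decide⟩, ⟨1, by decide⟩, ⟨2, by decide⟩].any fun u =>
      Nat.beq (N % edgePrime (v, u)) 0 && hasWalkWithin n u j (N / edgePrime (v, u))

theorem exists_walk_of_hasWalkWithin {n : ℕ} {v j : Fin 3} {E : List (Fin 3 × Fin 3)}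
    (h : hasWalkWithin n v j (E.map edgePrime).prod = true) :
    ∃ l : List (Fin 3), l.length = n ∧ l.getLastD v = j ∧ (walkEdges v l).Subperm E := by
  induction n generalizing v E with
  | zero => exact ⟨[], rfl, Fin.ext (Nat.eq_of_beq_eq_true h), List.nil_subperm⟩
  | succ n ih =>
    rw [hasWalkWithin, List.any_eq_true] at h
    obtain ⟨u, -, hu⟩ := h
    rw [Bool.and_eq_true] at hu
    have hmem : (v, u) ∈ E :=
      mem_of_edgePrime_dvd (Nat.dvd_of_mod_eq_zero (Nat.eq_of_beq_eq_true hu.1))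
    rw [prod_map_edgePrime_div hmem] at hu
    obtain ⟨l, hl, hj, hE⟩ := ih hu.2
    refine ⟨u :: l, by simp [hl], by rwa [List.getLastD_cons], ?_⟩
    exact ((List.subperm_cons _).2 hE).trans (List.perm_cons_erase hmem).symm.subperm

/-- Function application that makes the kernel evaluate the argument first, so that it can reuse
earlier evaluations of `f` at the same number. -/
def forceNat (f : ℕ → Bool) : ℕ → Bool
  | 0 => f 0
  | k + 1 => f (k + 1)

theorem forceNat_eq (f : ℕ → Bool) (n : ℕ) : forceNat f n = f n := by
  cases n <;> rfl

/-- Decide whether every extension by `d` steps of a walk of length `m` from `i` to `v` whose edges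
are encoded by `N` has a prefix that can be shortened by `6` steps using only its own edges. -/
def extensionsShorten : ℕ → ℕ → Fin 3 → Fin 3 → ℕ → Bool
  | 0, m, i, v, N => Nat.ble 6 m && hasWalkWithin (m - 6) i v N
  | d + 1, m, i, v, N =>
    (Nat.ble 6 m && hasWalkWithin (m - 6) i v N) ||
      [⟨0, by decide⟩, ⟨1, by decide⟩, ⟨2, by decide⟩].all fun u =>
        forceNat (extensionsShorten d (m + 1) i u) (edgePrime (v, u) * N)

theorem exists_shorter_of_hasWalkWithin {i v : Fin 3} {E : List (Fin 3 × Fin 3)}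
    (h : (Nat.ble 6 E.length &&
      hasWalkWithin (E.length - 6) i v (E.map edgePrime).prod) = true) (l : List (Fin 3)) :
    ∃ l' : List (Fin 3), l'.length + 6 = E.length + l.length ∧
      l'.getLastD i = l.getLastD v ∧ (walkEdges i l').Subperm (E ++ walkEdges v l) := by
  rw [Bool.and_eq_true, Nat.ble_eq] at h
  obtain ⟨l₀, hlen, hend, hE⟩ := exists_walk_of_hasWalkWithin h.2
  refine ⟨l₀ ++ l, ?_, ?_, ?_⟩
  · have := h.1
    simp only [List.length_append]
    omega
  · rw [getLastD_append_getLastD, hend]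
  · rw [walkEdges_append, hend]
    exact hE.append (List.Subperm.refl _)

theorem exists_shorter_of_extensionsShorten {d : ℕ} {i v : Fin 3} {E : List (Fin 3 × Fin 3)}
    (h : extensionsShorten d E.length i v (E.map edgePrime).prod = true) (l : List (Fin 3))
    (hl : l.length = d) :
    ∃ l' : List (Fin 3), l'.length + 6 = E.length + d ∧
      l'.getLastD i = l.getLastD v ∧ (walkEdges i l').Subperm (E ++ walkEdges v l) := by
  induction d generalizing v E l with
  | zero =>
    have := exists_shorter_of_hasWalkWithin h l
    rwa [hl] at this
  | succ d ih =>
    rw [extensionsShorten, Bool.or_eq_true] at h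
    rcases h with h | h
    · have := exists_shorter_of_hasWalkWithin h l
      rwa [hl] at this
    · obtain _ | ⟨u, l⟩ := l
      · simp at hl
      have hu := List.all_eq_true.1 h u (by fin_cases u <;> simp)
      rw [forceNat_eq] at hu
      obtain ⟨l', h₁, h₂, h₃⟩ := ih (E := (v, u) :: E) hu l (by simpa using hl)
      refine ⟨l', by simp only [List.length_cons] at h₁; omega, by rwa [List.getLastD_cons], ?_⟩
      exact h₃.trans List.perm_middle.symm.subperm

theorem extensionsShorten_eleven : ∀ i, extensionsShorten 11 0 i i 1 = true := by
  decide +kernel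

/-- A walk of length `6 k + 5` on three vertices contains, as a multiset of edges, a walk of
length `5` with the same endpoints. -/
theorem exists_walk_length_five (k : ℕ) (i : Fin 3) (l : List (Fin 3))
    (hl : l.length = 6 * k + 5) :
    ∃ l' : List (Fin 3), l'.length = 5 ∧ l'.getLastD i = l.getLastD i ∧
      (walkEdges i l').Subperm (walkEdges i l) := by
  induction k generalizing l with
  | zero => exact ⟨l, hl, rfl, List.Subperm.refl _⟩
  | succ k ih =>
    obtain ⟨l₁, h₁, h₂, h₃⟩ := exists_shorter_of_extensionsShorten (E := [])
      (extensionsShorten_eleven i) (l.take 11) (by rw [List.length_take]; omega)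
    rw [List.nil_append] at h₃
    obtain ⟨l', h₁', h₂', h₃'⟩ := ih (l₁ ++ l.drop 11) (by
      simp only [List.length_nil] at h₁
      rw [List.length_append, List.length_drop]
      omega)
    refine ⟨l', h₁', ?_, h₃'.trans ?_⟩
    · rw [h₂', getLastD_append_getLastD, h₂, ← getLastD_append_getLastD, List.take_append_drop]
    · rw [walkEdges_append, h₂]
      conv_rhs => rw [← List.take_append_drop 11 l, walkEdges_append]
      exact h₃.append (List.Subperm.refl _)

theorem coe_walkProd {L : Type*} [CommSemigroup L] {n l : ℕ} (A : Fin n → Fin n → L)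
    (V : Fin (l + 2) → Fin n) :
    ((walkProd A V : L) : WithOne L) = ((walkEdges (V 0) (List.ofFn fun t : Fin (l + 1) => V t.succ)).map
      fun e => (A e.1 e.2 : WithOne L)).prod := by
  induction l with
  | zero => simp [walkProd, walkEdges]
  | succ l ih =>
    rw [walkProd, WithOne.coe_mul, ih]
    conv_rhs => rw [List.ofFn_succ, walkEdges, List.map_cons, List.prod_cons]
    rfl

theorem getLastD_ofFn_succ {α : Type*} {l : ℕ} (V : Fin (l + 1) → α) :
    (List.ofFn fun t : Fin l => V t.succ).getLastD (V 0) = V (Fin.last l) := by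
  induction l with
  | zero => simp
  | succ l ih =>
    rw [List.ofFn_succ, List.getLastD_cons]
    exact ih fun t => V t.succ

theorem le_of_coe_dvd {L : Type*} [SemilatticeSup L] [CommSemigroup L]
    (habs : ∀ x y : L, x ⊔ x * y = x) {x y : L} (h : (x : WithOne L) ∣ y) : y ≤ x := by
  obtain ⟨c, hc⟩ := h
  induction c with
  | one =>
    rw [mul_one, WithOne.coe_inj] at hc
    exact hc.le
  | coe c =>
    rw [← WithOne.coe_mul, WithOne.coe_inj] at hc
    rw [hc, ← sup_eq_left]
    exact habs x c

/-- The weight of a walk of length `6 k + 5` on three vertices is divisible by the weight of a walk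
of length `5` with the same endpoints. -/
theorem exists_walkProd_dvd {L : Type*} [CommSemigroup L] (A : Fin 3 → Fin 3 → L) (k : ℕ)
    (V : Fin (6 * k + 4 + 2) → Fin 3) :
    ∃ W : Fin (4 + 2) → Fin 3, W 0 = V 0 ∧ W (Fin.last (4 + 1)) = V (Fin.last (6 * k + 4 + 1)) ∧
      ((walkProd A W : L) : WithOne L) ∣ ((walkProd A V : L) : WithOne L) := by
  obtain ⟨l, hl, hend, hE⟩ := exists_walk_length_five k (V 0)
    (List.ofFn fun t : Fin (6 * k + 4 + 1) => V t.succ) List.length_ofFn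
  obtain ⟨f, rfl⟩ : ∃ f : Fin 5 → Fin 3, l = List.ofFn f :=
    ⟨fun t => l.get (t.cast hl.symm), List.ext_getElem (hl.trans List.length_ofFn.symm)
      fun _ _ _ => by rw [List.getElem_ofFn]; rfl⟩
  rw [getLastD_ofFn_succ V] at hend
  let W : Fin (4 + 2) → Fin 3 := Fin.cons (V 0) f
  refine ⟨W, rfl, (getLastD_ofFn_succ W).symm.trans hend, ?_⟩
  rw [coe_walkProd, coe_walkProd]
  obtain ⟨E, hperm, hsub⟩ := hE
  have hprod := (hperm.map fun e => (A e.1 e.2 : WithOne L)).prod_eq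
  exact hprod.symm.dvd.trans (hsub.map _).prod_dvd_prod

theorem powEntry_le_powEntry_four {L : Type*} [SemilatticeSup L] [CommSemigroup L]
    (habs : ∀ x y : L, x ⊔ x * y = x) (A : Fin 3 → Fin 3 → L) (k : ℕ) (i j : Fin 3) :
    powEntry A (6 * k + 4) i j ≤ powEntry A 4 i j := by
  refine Finset.sup'_le _ _ fun V hV => ?_
  rw [Finset.mem_filter] at hV
  obtain ⟨-, hi, hj⟩ := hV
  obtain ⟨W, hWi, hWj, hdvd⟩ := exists_walkProd_dvd A k V
  exact (le_of_coe_dvd habs hdvd).trans (Finset.le_sup' (walkProd A)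
    (Finset.mem_filter.2 ⟨Finset.mem_univ W, hWi.trans hi, hWj.trans hj⟩))

/-- For every `3 × 3` matrix over a commutative incline, `A^233 ≤ A^5`
entrywise (note `A^233 = powEntry A 232` and `A^5 = powEntry A 4`). -/
theorem pow_233_le_pow_five
    {L : Type*} [SemilatticeSup L] [CommSemigroup L]
    (hdist : ∀ x y z : L, x * (y ⊔ z) = x * y ⊔ x * z)
    (habs : ∀ x y : L, x ⊔ x * y = x)
    (A : Fin 3 → Fin 3 → L) :
    ∀ i j : Fin 3, powEntry A 232 i j ≤ powEntry A 4 i j := by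
  exact powEntry_le_powEntry_four habs A 38
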